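/- Let $R$ be a commutative noetherian local ring and $M$ a finitely generated horizontally linked $R$-module (i.e. $M \cong \lambda^2 M$ with $\lambda = \Omega^1 \mathrm{Tr}$). Then the objects $(0 \to M)$ and $(M \xrightarrow{1} M)$ of the submodule category $\mathcal{S}$ are horizontally linked in the morphism category; indeed $\lambda_{\mathcal{M}}(0 \to M) \cong (\lambda M \xrightarrow{1} \lambda M)$ and $\lambda_{\mathcal{M}}(M \xrightarrow{1} M) \cong (0 \to \lambda M)$, so $\lambda_{\mathcal{M}}^2$ of each is isomorphic to itself. -/

import Mathlib

open LinearMap Function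

/-- A bundled module over a ring `S`. -/
structure Mdl (S : Type) [Ring S] : Type 1 where
  carrier : Type
  [ag : AddCommGroup carrier]
  [mod : Module S carrier]

attribute [instance] Mdl.ag Mdl.mod

instance {S : Type} [Ring S] : CoeSort (Mdl S) Type := ⟨Mdl.carrier⟩

/-- Bundle a module. -/
def Mdl.of (S : Type) [Ring S] (M : Type) [AddCommGroup M] [Module S M] : Mdl S := ⟨M⟩

section RingDefs

variable {S : Type} [Ring S]

/-- finitely generated projective -/
def FGProj (P : Mdl S) : Prop := Module.Projective S P.carrier ∧ Module.Finite S P.carrier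

/-- superfluous (small) submodule -/
def Superfluous {P : Type} [AddCommGroup P] [Module S P] (K : Submodule S P) : Prop :=
  ∀ N : Submodule S P, N ⊔ K = ⊤ → N = ⊤

/-- projective cover of a module -/
def IsProjCover {P M : Mdl S} (p : P.carrier →ₗ[S] M.carrier) : Prop :=
  FGProj P ∧ Function.Surjective p ∧ Superfluous (LinearMap.ker p)

/-- `N` is a (minimal) first syzygy of `M`. -/
def IsSyz1 (M N : Mdl S) : Prop :=
  ∃ (P : Mdl S) (p : P.carrier →ₗ[S] M.carrier),
    IsProjCover p ∧ Nonempty (N.carrier ≃ₗ[S] LinearMap.ker p)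

/-- `N` is an `n`-th (minimal) syzygy of `M`. -/
def IsSyz (n : ℕ) (M N : Mdl S) : Prop :=
  ∃ F : Fin (n + 1) → Mdl S,
    Nonempty ((F 0).carrier ≃ₗ[S] M.carrier) ∧
    Nonempty ((F (Fin.last n)).carrier ≃ₗ[S] N.carrier) ∧
    ∀ i : Fin n, IsSyz1 (F i.castSucc) (F i.succ)

/-- Gorenstein projective: a syzygy of a totally acyclic complex of
finitely generated projectives. -/
def IsGP (M : Mdl S) : Prop :=
  ∃ (P : ℤ → Mdl S) (d : ∀ i : ℤ, (P (i + 1)).carrier →ₗ[S] (P i).carrier),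
    (∀ i, FGProj (P i)) ∧
    (∀ i, LinearMap.range (d (i + 1)) = LinearMap.ker (d i)) ∧
    (∀ (Q : Mdl S), Module.Projective S Q.carrier →
      ∀ (i : ℤ) (g : (P (i + 1)).carrier →ₗ[S] Q.carrier), g ∘ₗ d (i + 1) = 0 →
        ∃ h : (P i).carrier →ₗ[S] Q.carrier, h ∘ₗ d i = g) ∧
    Nonempty (M.carrier ≃ₗ[S] LinearMap.ker (d 0))

/-- a map factoring through a projective module -/
def FactorsThruProj {A B : Mdl S} (φ : A.carrier →ₗ[S] B.carrier) : Prop :=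
  ∃ (Q : Mdl S) (α : A.carrier →ₗ[S] Q.carrier) (β : Q.carrier →ₗ[S] B.carrier),
    Module.Projective S Q.carrier ∧ β ∘ₗ α = φ

/-- `M` is stable: it has no nonzero projective direct summand. -/
def NoProjSummand (M : Mdl S) : Prop :=
  ∀ N Q : Mdl S, Nonempty (M.carrier ≃ₗ[S] (N.carrier × Q.carrier)) →
    Module.Projective S Q.carrier → Subsingleton Q.carrier

/-- indecomposable module -/
def IndecMod (M : Mdl S) : Prop :=
  Nontrivial M.carrier ∧
  ∀ N Q : Mdl S, Nonempty (M.carrier ≃ₗ[S] (N.carrier × Q.carrier)) →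
    Subsingleton N.carrier ∨ Subsingleton Q.carrier

end RingDefs
section MorCat

variable {R : Type} [CommRing R]

/-- An object of the morphism category `𝓜`. -/
structure MObj (R : Type) [CommRing R] : Type 1 where
  dom : Mdl R
  cod : Mdl R
  map : dom.carrier →ₗ[R] cod.carrier

/-- A morphism in the morphism category: a commutative square. -/
structure MHom (f g : MObj R) : Type where
  h1 : f.dom.carrier →ₗ[R] g.dom.carrier
  h2 : f.cod.carrier →ₗ[R] g.cod.carrier
  comm : g.map ∘ₗ h1 = h2 ∘ₗ f.map

/-- isomorphism in the morphism category -/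
def MIso (f g : MObj R) : Prop :=
  ∃ (e1 : f.dom.carrier ≃ₗ[R] g.dom.carrier) (e2 : f.cod.carrier ≃ₗ[R] g.cod.carrier),
    g.map ∘ₗ (e1 : f.dom.carrier →ₗ[R] g.dom.carrier)
      = (e2 : f.cod.carrier →ₗ[R] g.cod.carrier) ∘ₗ f.map

/-- epimorphism in the morphism category (componentwise surjective) -/
def MEpi {f g : MObj R} (φ : MHom f g) : Prop :=
  Function.Surjective φ.h1 ∧ Function.Surjective φ.h2

/-- projective object of the morphism category -/
def MProj (f : MObj R) : Prop :=
  ∀ (g h : MObj R) (e : MHom g h), MEpi e → ∀ φ : MHom f h,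
    ∃ ψ : MHom f g, e.h1 ∘ₗ ψ.h1 = φ.h1 ∧ e.h2 ∘ₗ ψ.h2 = φ.h2

/-- projective cover in the morphism category: a right minimal epimorphism
from a projective object -/
def MProjCover {q f : MObj R} (φ : MHom q f) : Prop :=
  MProj q ∧ MEpi φ ∧
  ∀ ξ : MHom q q, φ.h1 ∘ₗ ξ.h1 = φ.h1 → φ.h2 ∘ₗ ξ.h2 = φ.h2 →
    Function.Bijective ξ.h1 ∧ Function.Bijective ξ.h2

/-- `g` is a first syzygy of `f` in the morphism category. -/
def MSyz1 (f g : MObj R) : Prop :=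
  ∃ (q : MObj R) (φ : MHom q f), MProjCover φ ∧
    ∃ k : (LinearMap.ker φ.h1 : Type) →ₗ[R] (LinearMap.ker φ.h2 : Type),
      (LinearMap.ker φ.h2).subtype ∘ₗ k = q.map ∘ₗ (LinearMap.ker φ.h1).subtype ∧
      MIso g ⟨Mdl.of R (LinearMap.ker φ.h1), Mdl.of R (LinearMap.ker φ.h2), k⟩

/-- `g` is an `n`-th syzygy of `f` in the morphism category. -/
def MSyz (n : ℕ) (f g : MObj R) : Prop :=
  ∃ F : Fin (n + 1) → MObj R,
    MIso (F 0) f ∧ MIso (F (Fin.last n)) g ∧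
    ∀ i : Fin n, MSyz1 (F i.castSucc) (F i.succ)

/-- `g` is the induced map on (minimal) first syzygies of the map `f`. -/
def MapSyz1 (f g : MObj R) : Prop :=
  ∃ (PA PB : Mdl R) (pA : PA.carrier →ₗ[R] f.dom.carrier)
    (pB : PB.carrier →ₗ[R] f.cod.carrier) (L : PA.carrier →ₗ[R] PB.carrier),
    IsProjCover pA ∧ IsProjCover pB ∧ f.map ∘ₗ pA = pB ∘ₗ L ∧
    ∃ k : (LinearMap.ker pA : Type) →ₗ[R] (LinearMap.ker pB : Type),
      (LinearMap.ker pB).subtype ∘ₗ k = L ∘ₗ (LinearMap.ker pA).subtype ∧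
      MIso g ⟨Mdl.of R (LinearMap.ker pA), Mdl.of R (LinearMap.ker pB), k⟩

/-- `g` is the induced map on minimal `n`-th syzygies of the map `f`. -/
def MapSyz (n : ℕ) (f g : MObj R) : Prop :=
  ∃ F : Fin (n + 1) → MObj R,
    MIso (F 0) f ∧ MIso (F (Fin.last n)) g ∧
    ∀ i : Fin n, MapSyz1 (F i.castSucc) (F i.succ)

/-- direct sum in the morphism category -/
def DSum (f g : MObj R) : MObj R :=
  ⟨Mdl.of R (f.dom.carrier × g.dom.carrier), Mdl.of R (f.cod.carrier × g.cod.carrier),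
    f.map.prodMap g.map⟩

/-- the zero object, up to iso -/
def MTrivial (f : MObj R) : Prop := Subsingleton f.dom.carrier ∧ Subsingleton f.cod.carrier

/-- indecomposable object of the morphism category -/
def MIndec (f : MObj R) : Prop :=
  ¬ MTrivial f ∧ ∀ g h : MObj R, MIso f (DSum g h) → MTrivial g ∨ MTrivial h

/-- the endomorphism ring of `f` in the morphism category is local -/
def MEndLocal (f : MObj R) : Prop :=
  ¬ MTrivial f ∧
  ∀ ξ : MHom f f,
    (Function.Bijective ξ.h1 ∧ Function.Bijective ξ.h2) ∨
    (Function.Bijective ((LinearMap.id : f.dom.carrier →ₗ[R] f.dom.carrier) - ξ.h1) ∧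
     Function.Bijective ((LinearMap.id : f.cod.carrier →ₗ[R] f.cod.carrier) - ξ.h2))

/-- no nonzero projective direct summand in the morphism category -/
def MNoProjSummand (f : MObj R) : Prop :=
  ∀ g q : MObj R, MIso f (DSum g q) → MProj q → MTrivial q

/-- the cokernel module of an object -/
def CokMod (f : MObj R) : Mdl R := Mdl.of R (f.cod.carrier ⧸ LinearMap.range f.map)

/-- the cokernel object `Cok(f) : B → Cok f` -/
def CokObj (f : MObj R) : MObj R := ⟨f.cod, CokMod f, (LinearMap.range f.map).mkQ⟩

/-- Gorenstein projective objects of the morphism category -/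
def InG (f : MObj R) : Prop :=
  Function.Injective f.map ∧ IsGP f.dom ∧ IsGP (CokMod f)

/-- objects of `𝓗`: morphisms between Gorenstein projective modules -/
def InH (f : MObj R) : Prop := IsGP f.dom ∧ IsGP f.cod

/-- objects of `𝓔`: epimorphisms between Gorenstein projective modules -/
def InE (f : MObj R) : Prop := InH f ∧ Function.Surjective f.map

/-- `𝓖`-precover -/
def IsGPrecover {g x : MObj R} (φ : MHom g x) : Prop :=
  InG g ∧ ∀ g' : MObj R, InG g' → ∀ ψ : MHom g' x,
    ∃ ξ : MHom g' g, φ.h1 ∘ₗ ξ.h1 = ψ.h1 ∧ φ.h2 ∘ₗ ξ.h2 = ψ.h2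

/-- right minimal morphism -/
def MRightMin {g x : MObj R} (φ : MHom g x) : Prop :=
  ∀ ξ : MHom g g, φ.h1 ∘ₗ ξ.h1 = φ.h1 → φ.h2 ∘ₗ ξ.h2 = φ.h2 →
    Function.Bijective ξ.h1 ∧ Function.Bijective ξ.h2

/-- `𝓖`-cover -/
def IsGCover {g x : MObj R} (φ : MHom g x) : Prop := IsGPrecover φ ∧ MRightMin φ

/-- `𝓔`-preenvelope -/
def IsEPreenvelope {x e : MObj R} (φ : MHom x e) : Prop :=
  InE e ∧ ∀ e' : MObj R, InE e' → ∀ ψ : MHom x e',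
    ∃ ξ : MHom e e', ξ.h1 ∘ₗ φ.h1 = ψ.h1 ∧ ξ.h2 ∘ₗ φ.h2 = ψ.h2

/-- left minimal morphism -/
def MLeftMin {x e : MObj R} (φ : MHom x e) : Prop :=
  ∀ ξ : MHom e e, ξ.h1 ∘ₗ φ.h1 = φ.h1 → ξ.h2 ∘ₗ φ.h2 = φ.h2 →
    Function.Bijective ξ.h1 ∧ Function.Bijective ξ.h2

/-- `𝓔`-envelope -/
def IsEEnvelope {x e : MObj R} (φ : MHom x e) : Prop := IsEPreenvelope φ ∧ MLeftMin φ

/-- injective objects of `𝓗`: sums of `(P → P)` and `(P → 0)`,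
i.e. objects isomorphic to a projection `P × P' → P`. -/
def HInj (q : MObj R) : Prop :=
  ∃ P P' : Mdl R, FGProj P ∧ FGProj P' ∧
    MIso q ⟨Mdl.of R (P.carrier × P'.carrier), P, LinearMap.fst R P.carrier P'.carrier⟩

/-- no nonzero `𝓗`-injective direct summand -/
def MNoHInjSummand (f : MObj R) : Prop :=
  ∀ g q : MObj R, MIso f (DSum g q) → HInj q → MTrivial q

/-- `s` is (isomorphic to) the reduced `𝓖`-cover of `x` -/
def IsRedGCover (s x : MObj R) : Prop :=
  ∃ (g : MObj R) (φ : MHom g x), IsGCover φ ∧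
    ∃ q : MObj R, MProj q ∧ MIso g (DSum s q) ∧ MNoProjSummand s

/-- `s` is (isomorphic to) the reduced `𝓔`-envelope of `x` -/
def IsRedEEnvelope (s x : MObj R) : Prop :=
  ∃ (e : MObj R) (φ : MHom x e), IsEEnvelope φ ∧
    ∃ q : MObj R, HInj q ∧ MIso e (DSum s q) ∧ MNoHInjSummand s

/-- Auslander transpose of a module -/
def IsTranspose (M T : Mdl R) : Prop :=
  ∃ (P1 P0 : Mdl R) (d : P1.carrier →ₗ[R] P0.carrier) (p : P0.carrier →ₗ[R] M.carrier),
    FGProj P1 ∧ FGProj P0 ∧ Function.Surjective p ∧ Superfluous (LinearMap.ker p) ∧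
    LinearMap.range d = LinearMap.ker p ∧ Superfluous (LinearMap.ker d) ∧
    Nonempty (T.carrier ≃ₗ[R] (Module.Dual R P1.carrier ⧸ LinearMap.range d.dualMap))

/-- `L` is `λ M = Ω¹ Tr M`. -/
def LambdaOf (M L : Mdl R) : Prop := ∃ T : Mdl R, IsTranspose M T ∧ IsSyz1 T L

/-- horizontally linked module -/
def HorLinkedMod (M : Mdl R) : Prop :=
  ∃ L L2 : Mdl R, LambdaOf M L ∧ LambdaOf L L2 ∧ Nonempty (M.carrier ≃ₗ[R] L2.carrier)

/-- the Auslander transpose in the morphism category, computed by dualizing a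
(componentwise) minimal projective presentation
`(P₁ → P₁ ⊕ Q₁) → (P₀ → P₀ ⊕ Q₀) → f → 0` in `𝓜` against `𝐫 = (R → R ⊕ R)`. -/
def IsMTranspose (f t : MObj R) : Prop :=
  ∃ (P1 Q1 P0 Q0 : Mdl R)
    (u : P1.carrier →ₗ[R] P0.carrier)
    (v : (P1.carrier × Q1.carrier) →ₗ[R] (P0.carrier × Q0.carrier))
    (p : P0.carrier →ₗ[R] f.dom.carrier)
    (q : (P0.carrier × Q0.carrier) →ₗ[R] f.cod.carrier),
    FGProj P1 ∧ FGProj Q1 ∧ FGProj P0 ∧ FGProj Q0 ∧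
    v ∘ₗ LinearMap.inl R P1.carrier Q1.carrier = LinearMap.inl R P0.carrier Q0.carrier ∘ₗ u ∧
    q ∘ₗ LinearMap.inl R P0.carrier Q0.carrier = f.map ∘ₗ p ∧
    Function.Surjective p ∧ Function.Surjective q ∧
    Superfluous (LinearMap.ker p) ∧ Superfluous (LinearMap.ker q) ∧
    LinearMap.range u = LinearMap.ker p ∧ LinearMap.range v = LinearMap.ker q ∧
    Superfluous (LinearMap.ker u) ∧ Superfluous (LinearMap.ker v) ∧
    ∃ (e1 : t.dom.carrier ≃ₗ[R]
        (Module.Dual R Q1.carrier ⧸ LinearMap.range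
          (LinearMap.snd R P0.carrier Q0.carrier ∘ₗ v ∘ₗ
            LinearMap.inr R P1.carrier Q1.carrier).dualMap))
      (e2 : t.cod.carrier ≃ₗ[R]
        (Module.Dual R (P1.carrier × Q1.carrier) ⧸ LinearMap.range v.dualMap))
      (tt : (Module.Dual R Q1.carrier ⧸ LinearMap.range
          (LinearMap.snd R P0.carrier Q0.carrier ∘ₗ v ∘ₗ
            LinearMap.inr R P1.carrier Q1.carrier).dualMap) →ₗ[R]
        (Module.Dual R (P1.carrier × Q1.carrier) ⧸ LinearMap.range v.dualMap)),
      tt ∘ₗ (LinearMap.range (LinearMap.snd R P0.carrier Q0.carrier ∘ₗ v ∘ₗ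
          LinearMap.inr R P1.carrier Q1.carrier).dualMap).mkQ
        = (LinearMap.range v.dualMap).mkQ ∘ₗ (LinearMap.snd R P1.carrier Q1.carrier).dualMap ∧
      (e2 : t.cod.carrier →ₗ[R] _) ∘ₗ t.map = tt ∘ₗ (e1 : t.dom.carrier →ₗ[R] _)

/-- `g ≅ λ_𝓜 f = Ω¹_𝓜 Tr_𝓜 f` -/
def MLambda (f g : MObj R) : Prop := ∃ t : MObj R, IsMTranspose f t ∧ MSyz1 t g

/-- horizontally linked object of the submodule category -/
def MHorLinked (f : MObj R) : Prop :=
  ∃ g h : MObj R, MLambda f g ∧ MLambda g h ∧ MIso f h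

/-- the dual object `(B' → A')` of `(A → B)` -/
def DualObj (f : MObj R) : MObj R :=
  ⟨Mdl.of R (Module.Dual R f.cod.carrier), Mdl.of R (Module.Dual R f.dom.carrier), f.map.dualMap⟩

/-- componentwise short exact sequence in the morphism category -/
def MShortExact {a b c : MObj R} (φ : MHom a b) (ψ : MHom b c) : Prop :=
  Function.Injective φ.h1 ∧ Function.Injective φ.h2 ∧
  Function.Surjective ψ.h1 ∧ Function.Surjective ψ.h2 ∧
  LinearMap.range φ.h1 = LinearMap.ker ψ.h1 ∧
  LinearMap.range φ.h2 = LinearMap.ker ψ.h2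

/-- split monomorphism -/
def MSplitMono {a b : MObj R} (φ : MHom a b) : Prop :=
  ∃ σ : MHom b a, σ.h1 ∘ₗ φ.h1 = LinearMap.id ∧ σ.h2 ∘ₗ φ.h2 = LinearMap.id

/-- split epimorphism -/
def MSplitEpi {x c : MObj R} (θ : MHom x c) : Prop :=
  ∃ σ : MHom c x, θ.h1 ∘ₗ σ.h1 = LinearMap.id ∧ θ.h2 ∘ₗ σ.h2 = LinearMap.id

/-- almost split sequence in a full subcategory `C` of the morphism category -/
def IsAlmostSplitIn (C : MObj R → Prop) {a b c : MObj R}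
    (φ : MHom a b) (ψ : MHom b c) : Prop :=
  C a ∧ C b ∧ C c ∧ MShortExact φ ψ ∧ ¬ MSplitMono φ ∧ MEndLocal a ∧
  ∀ x : MObj R, C x → ∀ θ : MHom x c, ¬ MSplitEpi θ →
    ∃ ρ : MHom x b, ψ.h1 ∘ₗ ρ.h1 = θ.h1 ∧ ψ.h2 ∘ₗ ρ.h2 = θ.h2

end MorCat

/-- A Gorenstein local ring: noetherian local, and some fixed syzygy functor lands in
Gorenstein projective (maximal Cohen-Macaulay) modules. -/
def IsGorensteinLocal (R : Type) [CommRing R] : Prop :=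
  IsNoetherianRing R ∧ IsLocalRing R ∧
  ∃ n : ℕ, ∀ M : Mdl R, Module.Finite R M.carrier → ∀ N : Mdl R, IsSyz n M N → IsGP N


open TensorProduct in
/-- A finitely generated module over a local ring has a projective cover. -/
theorem exists_isProjCover {R : Type} [CommRing R] [IsLocalRing R] (T : Mdl R)
    [Module.Finite R T.carrier] :
    ∃ (P : Mdl R) (p : P.carrier →ₗ[R] T.carrier), IsProjCover p := by
  let k := IsLocalRing.ResidueField R
  let b := Module.Free.chooseBasis k (k ⊗[R] T.carrier)
  have hs : Function.Surjective (TensorProduct.mk R k T.carrier 1) :=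
    TensorProduct.mk_surjective R T.carrier k Ideal.Quotient.mk_surjective
  choose f hf using fun i => hs (b i)
  have hspan := IsLocalRing.span_eq_top_of_tmul_eq_basis f b hf
  have hsurj : Function.Surjective (Finsupp.linearCombination R f) := by
    rw [← LinearMap.range_eq_top, ← hspan]
    exact Finsupp.range_linearCombination R
  have hker : LinearMap.ker (Finsupp.linearCombination R f) ≤
      IsLocalRing.maximalIdeal R •
        (⊤ : Submodule R (Module.Free.ChooseBasisIndex k (k ⊗[R] T.carrier) →₀ R)) := by
    intro x hx
    have hx0 : ∑ i, IsLocalRing.residue R (x i) • b i = 0 := by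
      have h := congrArg (TensorProduct.mk R k T.carrier 1) (LinearMap.mem_ker.mp hx)
      rw [Finsupp.linearCombination_apply, Finsupp.sum_fintype _ _ (by simp), map_sum,
        map_zero] at h
      rw [← h]
      refine Finset.sum_congr rfl fun i _ => ?_
      rw [map_smul, hf]
      exact algebraMap_smul k (x i) (b i)
    have hxi := Fintype.linearIndependent_iff.mp b.linearIndependent _ hx0
    rw [← Finsupp.sum_single x]
    refine Submodule.sum_mem _ fun i _ => ?_
    rw [← mul_one (x i), ← smul_eq_mul, ← Finsupp.smul_single]
    exact Submodule.smul_mem_smul ((IsLocalRing.residue_eq_zero_iff _).mp (hxi i))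
      Submodule.mem_top
  have hsup : Superfluous (LinearMap.ker (Finsupp.linearCombination R f)) := fun N hN =>
    top_le_iff.mp (Submodule.le_of_le_smul_of_le_jacobson_bot
      (I := IsLocalRing.maximalIdeal R) Module.Finite.fg_top
      (IsLocalRing.maximalIdeal_le_jacobson _) (hN.symm.le.trans (sup_le_sup_left hker N)))
  exact ⟨Mdl.of R (Module.Free.ChooseBasisIndex k (k ⊗[R] T.carrier) →₀ R),
    Finsupp.linearCombination R f,
    ⟨inferInstanceAs (Module.Projective R (_ →₀ R)), inferInstanceAs (Module.Finite R (_ →₀ R))⟩,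
    hsurj, hsup⟩

section Superfluous

variable {S : Type} [Ring S] {P P' X X' : Type} [AddCommGroup P] [Module S P]
  [AddCommGroup P'] [Module S P'] [AddCommGroup X] [Module S X] [AddCommGroup X'] [Module S X']

theorem Superfluous.ker_of_equiv {f : P →ₗ[S] X} (hf : Superfluous (LinearMap.ker f))
    {f' : P' →ₗ[S] X'} (e : P' ≃ₗ[S] P) (h : ∀ x, f' x = 0 ↔ f (e x) = 0) :
    Superfluous (LinearMap.ker f') := by
  intro N hN
  have hk : (LinearMap.ker f').map e.toLinearMap = LinearMap.ker f := by
    ext y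
    constructor
    · rintro ⟨x, hx, rfl⟩
      exact (h x).mp hx
    · intro hy
      exact ⟨e.symm y, (h _).mpr (by simpa using hy), by simp⟩
  have := hf (N.map e.toLinearMap) (by
    rw [← hk, ← Submodule.map_sup, hN, Submodule.map_top, LinearEquiv.range])
  refine Submodule.map_injective_of_injective (f := e.toLinearMap) e.injective ?_
  rw [this, Submodule.map_top, LinearEquiv.range]

theorem Superfluous.surjective_of_range_le_range_comp {p : P →ₗ[S] X}
    (hp : Superfluous (LinearMap.ker p)) (h : P' →ₗ[S] P)
    (hs : LinearMap.range p ≤ LinearMap.range (p ∘ₗ h)) : Function.Surjective h := by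
  rw [← LinearMap.range_eq_top]
  refine hp _ (eq_top_iff.mpr fun x _ => ?_)
  obtain ⟨y, hy⟩ := hs ⟨x, rfl⟩
  refine Submodule.mem_sup.mpr ⟨h y, ⟨y, rfl⟩, x - h y, ?_, by abel⟩
  rw [LinearMap.mem_ker, map_sub, sub_eq_zero, ← hy, LinearMap.comp_apply]

theorem Superfluous.subsingleton_of_ker [Subsingleton X] {p : P →ₗ[S] X}
    (hp : Superfluous (LinearMap.ker p)) : Subsingleton P := by
  have h := hp ⊥ (by rw [eq_top_iff]; intro x _; simp [Subsingleton.elim (p x) 0])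
  exact (Submodule.subsingleton_iff S).mp (subsingleton_of_bot_eq_top h)

theorem superfluous_of_subsingleton [Subsingleton P] (K : Submodule S P) : Superfluous K :=
  fun N _ => Subsingleton.elim N ⊤

theorem fgProj_of_subsingleton (Q : Mdl S) [Subsingleton Q.carrier] : FGProj Q :=
  ⟨inferInstance, inferInstance⟩

end Superfluous

section Morphisms

variable {R : Type} [CommRing R]

theorem IsProjCover.bijective {P M : Mdl R} {p : P.carrier →ₗ[R] M.carrier} (hp : IsProjCover p)
    (ξ : P.carrier →ₗ[R] P.carrier) (hξ : p ∘ₗ ξ = p) : Function.Bijective ξ :=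
  have := hp.1.2
  OrzechProperty.bijective_of_surjective_endomorphism ξ
    (hp.2.2.surjective_of_range_le_range_comp ξ (congrArg LinearMap.range hξ).ge)

theorem MIso.symm {f g : MObj R} : MIso f g → MIso g f := by
  rintro ⟨e1, e2, h⟩
  refine ⟨e1.symm, e2.symm, LinearMap.ext fun x => e2.injective ?_⟩
  simpa using (LinearMap.congr_fun h (e1.symm x)).symm

theorem MIso.trans {f g h : MObj R} : MIso f g → MIso g h → MIso f h := by
  rintro ⟨e1, e2, he⟩ ⟨e1', e2', he'⟩
  refine ⟨e1.trans e1', e2.trans e2', LinearMap.ext fun x => ?_⟩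
  have h1 := LinearMap.congr_fun he x
  have h2 := LinearMap.congr_fun he' (e1 x)
  simp only [LinearMap.comp_apply, LinearEquiv.coe_coe] at h1 h2
  simp [h2, h1]

theorem MIso.of_bijective {f : MObj R} (hf : Function.Bijective f.map) {L : Mdl R}
    (e : f.dom.carrier ≃ₗ[R] L.carrier) : MIso f ⟨L, L, LinearMap.id⟩ := by
  refine ⟨e, (LinearEquiv.ofBijective f.map hf).symm.trans e, LinearMap.ext fun x => ?_⟩
  have : (LinearEquiv.ofBijective f.map hf).symm (f.map x) = x :=
    (LinearEquiv.ofBijective f.map hf).symm_apply_apply x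
  simp [this]

theorem MIso.of_subsingleton {f : MObj R} (hf : Subsingleton f.dom.carrier) {Z L : Mdl R}
    [Subsingleton Z.carrier] (e : f.cod.carrier ≃ₗ[R] L.carrier) : MIso f ⟨Z, L, 0⟩ := by
  refine ⟨LinearEquiv.ofSubsingleton _ _, e, LinearMap.ext fun x => ?_⟩
  simp [Subsingleton.elim x 0]

/-- Two projective covers of the same object of the morphism category have isomorphic kernels. -/
theorem MProjCover.kernel_iso {t q q' : MObj R} {φ : MHom q t} {φ' : MHom q' t}
    (hφ : MProjCover φ) (hφ' : MProjCover φ')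
    (k : LinearMap.ker φ.h1 →ₗ[R] LinearMap.ker φ.h2)
    (hk : (LinearMap.ker φ.h2).subtype ∘ₗ k = q.map ∘ₗ (LinearMap.ker φ.h1).subtype)
    (k' : LinearMap.ker φ'.h1 →ₗ[R] LinearMap.ker φ'.h2)
    (hk' : (LinearMap.ker φ'.h2).subtype ∘ₗ k' = q'.map ∘ₗ (LinearMap.ker φ'.h1).subtype) :
    MIso ⟨Mdl.of R (LinearMap.ker φ.h1), Mdl.of R (LinearMap.ker φ.h2), k⟩
      ⟨Mdl.of R (LinearMap.ker φ'.h1), Mdl.of R (LinearMap.ker φ'.h2), k'⟩ := by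
  obtain ⟨ψ, h1, h2⟩ := hφ.1 _ _ φ' hφ'.2.1 φ
  obtain ⟨ψ', h1', h2'⟩ := hφ'.1 _ _ φ hφ.2.1 φ'
  have b := hφ.2.2 ⟨ψ'.h1 ∘ₗ ψ.h1, ψ'.h2 ∘ₗ ψ.h2, by
      rw [← LinearMap.comp_assoc, ψ'.comm, LinearMap.comp_assoc, ψ.comm, LinearMap.comp_assoc]⟩
    (by rw [← LinearMap.comp_assoc, h1', h1]) (by rw [← LinearMap.comp_assoc, h2', h2])
  have b' := hφ'.2.2 ⟨ψ.h1 ∘ₗ ψ'.h1, ψ.h2 ∘ₗ ψ'.h2, by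
      rw [← LinearMap.comp_assoc, ψ.comm, LinearMap.comp_assoc, ψ'.comm, LinearMap.comp_assoc]⟩
    (by rw [← LinearMap.comp_assoc, h1, h1']) (by rw [← LinearMap.comp_assoc, h2, h2'])
  simp only [LinearMap.coe_comp] at b b'
  let e1 := LinearEquiv.ofBijective ψ.h1 ⟨b.1.1.of_comp, b'.1.2.of_comp⟩
  let e2 := LinearEquiv.ofBijective ψ.h2 ⟨b.2.1.of_comp, b'.2.2.of_comp⟩
  have he1 : (LinearMap.ker φ.h1).map e1.toLinearMap = LinearMap.ker φ'.h1 := by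
    rw [← h1]
    exact (congrArg _ (LinearMap.ker_comp ψ.h1 φ'.h1)).trans
      (Submodule.map_comap_eq_of_surjective e1.surjective _)
  have he2 : (LinearMap.ker φ.h2).map e2.toLinearMap = LinearMap.ker φ'.h2 := by
    rw [← h2]
    exact (congrArg _ (LinearMap.ker_comp ψ.h2 φ'.h2)).trans
      (Submodule.map_comap_eq_of_surjective e2.surjective _)
  refine ⟨e1.ofSubmodules _ _ he1, e2.ofSubmodules _ _ he2, LinearMap.ext fun x =>
    Subtype.ext ?_⟩
  have c1 := LinearMap.congr_fun hk' (e1.ofSubmodules _ _ he1 x)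
  have c2 := LinearMap.congr_fun hk x
  have c3 := LinearMap.congr_fun ψ.comm x.1
  exact c1.trans (c3.trans (congrArg ψ.h2 c2.symm))

theorem MSyz1.iso_of_mprojCover {t g q : MObj R} (h : MSyz1 t g) {φ : MHom q t}
    (hφ : MProjCover φ) (k : LinearMap.ker φ.h1 →ₗ[R] LinearMap.ker φ.h2)
    (hk : (LinearMap.ker φ.h2).subtype ∘ₗ k = q.map ∘ₗ (LinearMap.ker φ.h1).subtype) :
    MIso g ⟨Mdl.of R (LinearMap.ker φ.h1), Mdl.of R (LinearMap.ker φ.h2), k⟩ := by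
  obtain ⟨q', φ', hφ', k', hk', hg⟩ := h
  exact hg.trans (hφ'.kernel_iso hφ k' hk' k hk)

/-- The morphism from the identity of `P` induced by a map from `P` to the domain. -/
def MHom.ofId (t : MObj R) {P : Mdl R} (p : P.carrier →ₗ[R] t.dom.carrier) :
    MHom ⟨P, P, LinearMap.id⟩ t :=
  ⟨p, t.map ∘ₗ p, rfl⟩

/-- The morphism from the zero map `Z → P` induced by a map from `P` to the codomain. -/
def MHom.ofZero (t : MObj R) (Z : Mdl R) {P : Mdl R} (p : P.carrier →ₗ[R] t.cod.carrier) :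
    MHom ⟨Z, P, 0⟩ t :=
  ⟨0, p, by simp⟩

theorem MHom.mprojCover_ofId {t : MObj R} (ht : Function.Bijective t.map) {P : Mdl R}
    {p : P.carrier →ₗ[R] t.dom.carrier} (hp : IsProjCover p) : MProjCover (MHom.ofId t p) := by
  have := hp.1.1
  refine ⟨fun g h e he φ => ?_, ⟨hp.2.1, ht.2.comp hp.2.1⟩, fun ξ h1 _ => ?_⟩
  · obtain ⟨ψ, hψ⟩ := Module.projective_lifting_property e.h1 φ.h1 he.1
    refine ⟨⟨ψ, g.map ∘ₗ ψ, rfl⟩, hψ, ?_⟩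
    rw [← LinearMap.comp_assoc, ← e.comm, LinearMap.comp_assoc, hψ, φ.comm]
    rfl
  · have hb := hp.bijective ξ.h1 h1
    have hc : ξ.h1 = ξ.h2 := ξ.comm
    exact ⟨hb, hc ▸ hb⟩

theorem MHom.mprojCover_ofZero {t : MObj R} [Subsingleton t.dom.carrier] {Z P : Mdl R}
    [Subsingleton Z.carrier] {p : P.carrier →ₗ[R] t.cod.carrier} (hp : IsProjCover p) :
    MProjCover (MHom.ofZero t Z p) := by
  have := hp.1.1
  refine ⟨fun g h e he φ => ?_, ⟨fun y => ⟨0, Subsingleton.elim _ _⟩, hp.2.1⟩, fun ξ _ h2 => ?_⟩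
  · obtain ⟨ψ, hψ⟩ := Module.projective_lifting_property e.h2 φ.h2 he.2
    refine ⟨⟨0, ψ, by simp⟩, LinearMap.ext fun x => ?_, hψ⟩
    simp [Subsingleton.elim x 0]
  · exact ⟨⟨fun _ _ _ => Subsingleton.elim _ _, fun y => ⟨0, Subsingleton.elim _ _⟩⟩,
      hp.bijective ξ.h2 h2⟩

/-- The map induced on the kernels of the components of `MHom.ofId t p`. -/
def MHom.kerOfId (t : MObj R) {P : Mdl R} (p : P.carrier →ₗ[R] t.dom.carrier) :
    LinearMap.ker (MHom.ofId t p).h1 →ₗ[R] LinearMap.ker (MHom.ofId t p).h2 :=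
  Submodule.inclusion (LinearMap.ker_le_ker_comp p t.map)

theorem MHom.kerOfId_bijective {t : MObj R} (ht : Function.Injective t.map) {P : Mdl R}
    (p : P.carrier →ₗ[R] t.dom.carrier) : Function.Bijective (MHom.kerOfId t p) :=
  ⟨Submodule.inclusion_injective _, fun y =>
    ⟨⟨y.1, ht ((LinearMap.mem_ker.mp y.2).trans (map_zero t.map).symm)⟩, rfl⟩⟩

theorem IsSyz1.msyz1_id {T L : Mdl R} (h : IsSyz1 T L) :
    MSyz1 ⟨T, T, LinearMap.id⟩ ⟨L, L, LinearMap.id⟩ := by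
  obtain ⟨P, p, hp, ⟨e⟩⟩ := h
  let t : MObj R := ⟨T, T, LinearMap.id⟩
  have ht : Function.Bijective t.map := Function.bijective_id
  exact ⟨_, MHom.ofId t p, MHom.mprojCover_ofId ht hp, MHom.kerOfId t p, rfl,
    (MIso.of_bijective (MHom.kerOfId_bijective ht.1 p) e.symm).symm⟩

theorem IsSyz1.msyz1_zero {Z T L : Mdl R} [Subsingleton Z.carrier] (h : IsSyz1 T L) :
    MSyz1 ⟨Z, T, 0⟩ ⟨Z, L, 0⟩ := by
  obtain ⟨P, p, hp, ⟨e⟩⟩ := h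
  have hZ : Subsingleton (LinearMap.ker (MHom.ofZero ⟨Z, T, 0⟩ Z p).h1) :=
    inferInstanceAs (Subsingleton (LinearMap.ker (0 : Z.carrier →ₗ[R] Z.carrier)))
  refine ⟨_, MHom.ofZero _ Z p, MHom.mprojCover_ofZero hp, 0, LinearMap.ext fun x => rfl, ?_⟩
  exact MIso.symm (MIso.of_subsingleton hZ e.symm)

theorem MSyz1.exists_iso_id {t g : MObj R} [IsLocalRing R] [Module.Finite R t.dom.carrier]
    (ht : Function.Bijective t.map) (h : MSyz1 t g) :
    ∃ L : Mdl R, IsSyz1 t.dom L ∧ MIso g ⟨L, L, LinearMap.id⟩ := by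
  obtain ⟨P, p, hp⟩ := exists_isProjCover t.dom
  refine ⟨Mdl.of R (LinearMap.ker p), ⟨P, p, hp, ⟨LinearEquiv.refl R _⟩⟩, ?_⟩
  exact (h.iso_of_mprojCover (MHom.mprojCover_ofId ht hp) (MHom.kerOfId t p) rfl).trans
    (MIso.of_bijective (MHom.kerOfId_bijective ht.1 p) (LinearEquiv.refl R _))

theorem MSyz1.exists_iso_zero {t g : MObj R} [IsLocalRing R] [Module.Finite R t.cod.carrier]
    [Subsingleton t.dom.carrier] (h : MSyz1 t g) (Z : Mdl R) [Subsingleton Z.carrier] :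
    ∃ L : Mdl R, IsSyz1 t.cod L ∧ MIso g ⟨Z, L, 0⟩ := by
  obtain ⟨P, p, hp⟩ := exists_isProjCover t.cod
  refine ⟨Mdl.of R (LinearMap.ker p), ⟨P, p, hp, ⟨LinearEquiv.refl R _⟩⟩, ?_⟩
  have hZ : Subsingleton (LinearMap.ker (MHom.ofZero t Z p).h1) :=
    inferInstanceAs (Subsingleton (LinearMap.ker (0 : Z.carrier →ₗ[R] t.dom.carrier)))
  exact (h.iso_of_mprojCover (MHom.mprojCover_ofZero (Z := Z) hp) 0
    (LinearMap.ext fun x => rfl)).trans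
    (MIso.of_subsingleton hZ (LinearEquiv.refl R (LinearMap.ker p)))

section Transpose

variable {P1 P0 P1' P0' : Type} [AddCommGroup P1] [Module R P1] [AddCommGroup P0] [Module R P0]
  [AddCommGroup P1'] [Module R P1'] [AddCommGroup P0'] [Module R P0']

/-- Isomorphic maps have isomorphic cokernels of duals. -/
def dualCokerEquiv {d : P1 →ₗ[R] P0} {d' : P1' →ₗ[R] P0'} (e1 : P1 ≃ₗ[R] P1')
    (e0 : P0 ≃ₗ[R] P0') (h : e0.toLinearMap ∘ₗ d = d' ∘ₗ e1.toLinearMap) :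
    (Module.Dual R P1' ⧸ LinearMap.range d'.dualMap) ≃ₗ[R]
      (Module.Dual R P1 ⧸ LinearMap.range d.dualMap) :=
  Submodule.Quotient.equiv _ _ e1.dualMap (by
    have hd : e1.dualMap.toLinearMap ∘ₗ d'.dualMap = d.dualMap ∘ₗ e0.dualMap.toLinearMap := by
      ext φ x
      exact (congrArg φ (LinearMap.congr_fun h x)).symm
    rw [← LinearMap.range_comp, hd, LinearMap.range_comp_of_range_eq_top _ e0.dualMap.range])

variable (R) in
/-- Projection away from a trivial first factor. -/
def sndEquivOfSubsingleton (Z Q : Type) [AddCommGroup Z] [Module R Z] [AddCommGroup Q]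
    [Module R Q] [Subsingleton Z] : (Z × Q) ≃ₗ[R] Q :=
  { LinearMap.snd R Z Q with
    invFun := fun x => (0, x)
    left_inv := fun _ => Prod.ext (Subsingleton.elim _ _) rfl
    right_inv := fun _ => rfl }

variable (R) in
/-- Projection away from a trivial second factor. -/
def fstEquivOfSubsingleton (Q Z : Type) [AddCommGroup Z] [Module R Z] [AddCommGroup Q]
    [Module R Q] [Subsingleton Z] : (Q × Z) ≃ₗ[R] Q :=
  { LinearMap.fst R Q Z with
    invFun := fun x => (x, 0)
    left_inv := fun _ => Prod.ext rfl (Subsingleton.elim _ _)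
    right_inv := fun _ => rfl }

end Transpose

theorem IsTranspose.finite [IsNoetherianRing R] {M T : Mdl R} (h : IsTranspose M T) :
    Module.Finite R T.carrier := by
  obtain ⟨P1, P0, d, p, h1, -, -, -, -, -, ⟨e⟩⟩ := h
  have := h1.1
  have := h1.2
  exact Module.Finite.equiv e.symm

theorem IsTranspose.isMTranspose_zero {Z M T : Mdl R} [Subsingleton Z.carrier]
    (h : IsTranspose M T) : IsMTranspose ⟨Z, M, 0⟩ ⟨T, T, LinearMap.id⟩ := by
  obtain ⟨P1, P0, d, p, h1, h0, hp, hsp, hdp, hsd, ⟨e⟩⟩ := h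
  have hcok : (sndEquivOfSubsingleton R Z.carrier P0.carrier).toLinearMap ∘ₗ
      LinearMap.prodMap 0 d =
      (LinearMap.snd R Z.carrier P0.carrier ∘ₗ LinearMap.prodMap 0 d ∘ₗ
        LinearMap.inr R Z.carrier P1.carrier) ∘ₗ
        (sndEquivOfSubsingleton R Z.carrier P1.carrier).toLinearMap := rfl
  refine ⟨Z, P1, Z, P0, 0, LinearMap.prodMap 0 d, 0, p ∘ₗ LinearMap.snd R _ _,
    fgProj_of_subsingleton Z, h1, fgProj_of_subsingleton Z, h0, ?_, ?_,
    fun y => ⟨0, Subsingleton.elim (α := Z.carrier) _ _⟩, hp.comp Prod.snd_surjective,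
    superfluous_of_subsingleton _,
    hsp.ker_of_equiv (sndEquivOfSubsingleton R _ _) fun x => Iff.rfl,
    Subsingleton.elim (α := Submodule R Z.carrier) _ _, ?_, superfluous_of_subsingleton _,
    hsd.ker_of_equiv (sndEquivOfSubsingleton R _ _) fun x => ?_,
    e, e.trans (dualCokerEquiv _ _ hcok), (dualCokerEquiv _ _ hcok).toLinearMap, rfl, rfl⟩
  · refine LinearMap.ext fun x => ?_
    rw [Subsingleton.elim x 0, map_zero, map_zero]
  · refine LinearMap.ext fun x => ?_
    rw [Subsingleton.elim x 0, map_zero, map_zero]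
  · rw [LinearMap.ker_comp, ← hdp]
    ext ⟨z, x⟩
    constructor
    · rintro ⟨y, hy⟩
      exact ⟨y.2, congrArg Prod.snd hy⟩
    · rintro ⟨y, hy⟩
      exact ⟨(0, y), Prod.ext (Subsingleton.elim _ _) hy⟩
  · exact ⟨fun hx => congrArg Prod.snd hx, fun hx => Prod.ext rfl hx⟩

theorem IsTranspose.isMTranspose_id {Z M T : Mdl R} [Subsingleton Z.carrier]
    (h : IsTranspose M T) : IsMTranspose ⟨M, M, LinearMap.id⟩ ⟨Z, T, 0⟩ := by
  obtain ⟨P1, P0, d, p, h1, h0, hp, hsp, hdp, hsd, ⟨e⟩⟩ := h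
  have hcok : (fstEquivOfSubsingleton R P0.carrier Z.carrier).toLinearMap ∘ₗ
      LinearMap.prodMap d 0 = d ∘ₗ
        (fstEquivOfSubsingleton R P1.carrier Z.carrier).toLinearMap := rfl
  have hD : Subsingleton (Module.Dual R Z.carrier) :=
    ⟨fun a b => LinearMap.ext fun x => by rw [Subsingleton.elim x 0, map_zero, map_zero]⟩
  refine ⟨P1, Z, P0, Z, d, LinearMap.prodMap d 0, p, p ∘ₗ LinearMap.fst R _ _,
    h1, fgProj_of_subsingleton Z, h0, fgProj_of_subsingleton Z, LinearMap.ext fun x => rfl,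
    rfl, hp, hp.comp Prod.fst_surjective, hsp,
    hsp.ker_of_equiv (fstEquivOfSubsingleton R _ _) fun x => Iff.rfl, hdp, ?_, hsd,
    hsd.ker_of_equiv (fstEquivOfSubsingleton R _ _) fun x => ?_,
    LinearEquiv.ofSubsingleton _ _, e.trans (dualCokerEquiv _ _ hcok), 0, ?_, ?_⟩
  · rw [LinearMap.ker_comp, ← hdp]
    ext ⟨x, z⟩
    constructor
    · rintro ⟨y, hy⟩
      exact ⟨y.1, congrArg Prod.fst hy⟩
    · rintro ⟨y, hy⟩
      exact ⟨(y, 0), Prod.ext hy (Subsingleton.elim _ _)⟩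
  · exact ⟨fun hx => congrArg Prod.fst hx, fun hx => Prod.ext hx rfl⟩
  · refine LinearMap.ext fun x => ?_
    rw [Subsingleton.elim x 0, map_zero, map_zero]
  · rw [LinearMap.comp_zero, LinearMap.zero_comp]

theorem IsMTranspose.bijective_and_isTranspose_dom {Z M : Mdl R} [Subsingleton Z.carrier]
    {t : MObj R} (h : IsMTranspose ⟨Z, M, 0⟩ t) :
    Function.Bijective t.map ∧ IsTranspose M t.dom := by
  obtain ⟨P1, Q1, P0, Q0, u, v, p, q, -, hQ1, -, hQ0, -, -, -, hq, hsp, hsq, hu, hv, hsu, hsv,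
    e1, e2, tt, htt, ht⟩ := h
  have : Subsingleton P0.carrier := hsp.subsingleton_of_ker
  have : Subsingleton P1.carrier := hsu.subsingleton_of_ker
  let d := LinearMap.snd R P0.carrier Q0.carrier ∘ₗ v ∘ₗ LinearMap.inr R P1.carrier Q1.carrier
  have hd (x : P1.carrier × Q1.carrier) : (v x).2 = d x.2 :=
    congrArg (fun y => (v y).2) (Prod.ext (Subsingleton.elim _ _) rfl)
  have hcok : (sndEquivOfSubsingleton R P0.carrier Q0.carrier).toLinearMap ∘ₗ v =
      d ∘ₗ (sndEquivOfSubsingleton R P1.carrier Q1.carrier).toLinearMap :=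
    LinearMap.ext hd
  have htt' : tt = (dualCokerEquiv _ _ hcok).toLinearMap := Submodule.linearMap_qext _ htt
  constructor
  · have hb : Function.Bijective (e2.toLinearMap ∘ₗ t.map) := by
      rw [ht, htt']
      exact (dualCokerEquiv _ _ hcok).bijective.comp e1.bijective
    exact (Function.Bijective.of_comp_iff' e2.bijective _).mp hb
  · refine ⟨Q1, Q0, d, q ∘ₗ LinearMap.inr R _ _, hQ1, hQ0,
      hq.comp (sndEquivOfSubsingleton R P0.carrier Q0.carrier).symm.surjective,
      hsq.ker_of_equiv (sndEquivOfSubsingleton R P0.carrier Q0.carrier).symm fun x => Iff.rfl, ?_,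
      hsv.ker_of_equiv (sndEquivOfSubsingleton R P1.carrier Q1.carrier).symm fun x =>
        ⟨fun hx => Prod.ext (Subsingleton.elim _ _) hx, fun hx => congrArg Prod.snd hx⟩, ⟨e1⟩⟩
    rw [LinearMap.ker_comp, ← hv]
    ext x
    constructor
    · rintro ⟨y, hy⟩
      exact ⟨(0, y), Prod.ext (Subsingleton.elim _ _) hy⟩
    · rintro ⟨y, hy⟩
      exact ⟨y.2, (hd y).symm.trans (congrArg Prod.snd hy)⟩

theorem subsingleton_of_surjective_inl {P Q : Type} [AddCommGroup P] [Module R P]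
    [AddCommGroup Q] [Module R Q] (h : Function.Surjective (LinearMap.inl R P Q)) :
    Subsingleton Q :=
  subsingleton_of_forall_eq 0 fun y => by
    obtain ⟨x, hx⟩ := h (0, y)
    exact (congrArg Prod.snd hx).symm

theorem IsMTranspose.subsingleton_and_isTranspose_cod {M : Mdl R} {t : MObj R}
    (h : IsMTranspose ⟨M, M, LinearMap.id⟩ t) :
    Subsingleton t.dom.carrier ∧ IsTranspose M t.cod := by
  obtain ⟨P1, Q1, P0, Q0, u, v, p, q, hP1, -, hP0, -, huv, hpq, hp, -, hsp, hsq, hu, hv, hsu, hsv,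
    e1, e2, -⟩ := h
  have hpq' : q ∘ₗ LinearMap.inl R P0.carrier Q0.carrier = p := hpq
  have hQ0 : Subsingleton Q0.carrier := subsingleton_of_surjective_inl (R := R)
    (hsq.surjective_of_range_le_range_comp (LinearMap.inl R _ _) (by
      rw [hpq', LinearMap.range_eq_top.mpr hp]
      exact le_top))
  have hQ1 : Subsingleton Q1.carrier := subsingleton_of_surjective_inl (R := R)
    (hsv.surjective_of_range_le_range_comp (LinearMap.inl R _ _) (by
      rw [hv, huv]
      intro z hz
      have hz' : z = LinearMap.inl R _ _ z.1 := Prod.ext rfl (Subsingleton.elim _ _)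
      have hzu : z.1 ∈ LinearMap.range u := by
        rw [hu, ← hpq', LinearMap.mem_ker, LinearMap.comp_apply, ← hz']
        exact hz
      obtain ⟨y, hy⟩ := hzu
      exact ⟨y, by rw [LinearMap.comp_apply, hy, ← hz']⟩))
  have hD : Subsingleton (Module.Dual R Q1.carrier) :=
    ⟨fun a b => LinearMap.ext fun x => by rw [Subsingleton.elim x 0, map_zero, map_zero]⟩
  have hcok : (fstEquivOfSubsingleton R P0.carrier Q0.carrier).symm.toLinearMap ∘ₗ u =
      v ∘ₗ (fstEquivOfSubsingleton R P1.carrier Q1.carrier).symm.toLinearMap := huv.symm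
  exact ⟨e1.toEquiv.subsingleton, P1, P0, u, p, hP1, hP0, hp, hsp, hu, hsu,
    ⟨e2.trans (dualCokerEquiv _ _ hcok)⟩⟩

theorem LambdaOf.mlambda_zero {Z M L : Mdl R} [Subsingleton Z.carrier] (h : LambdaOf M L) :
    MLambda ⟨Z, M, 0⟩ ⟨L, L, LinearMap.id⟩ := by
  obtain ⟨T, hT, hL⟩ := h
  exact ⟨_, hT.isMTranspose_zero, hL.msyz1_id⟩

theorem LambdaOf.mlambda_id {Z M L : Mdl R} [Subsingleton Z.carrier] (h : LambdaOf M L) :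
    MLambda ⟨M, M, LinearMap.id⟩ ⟨Z, L, 0⟩ := by
  obtain ⟨T, hT, hL⟩ := h
  exact ⟨_, hT.isMTranspose_id, hL.msyz1_zero⟩

end Morphisms

theorem statement16 (R : Type) [CommRing R] [IsNoetherianRing R] [IsLocalRing R]
    (M : Mdl R) (hfin : Module.Finite R M.carrier) (hM : HorLinkedMod M) :
    (∀ g : MObj R, MLambda (⟨Mdl.of R PUnit, M, 0⟩ : MObj R) g →
      ∃ L : Mdl R, LambdaOf M L ∧ MIso g ⟨L, L, LinearMap.id⟩) ∧
    (∀ g : MObj R, MLambda (⟨M, M, LinearMap.id⟩ : MObj R) g →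
      ∃ L : Mdl R, LambdaOf M L ∧ MIso g ⟨Mdl.of R PUnit, L, 0⟩) ∧
    MHorLinked (⟨Mdl.of R PUnit, M, 0⟩ : MObj R) ∧
    MHorLinked (⟨M, M, LinearMap.id⟩ : MObj R) := by
  have hZ : Subsingleton (Mdl.of R PUnit).carrier := inferInstanceAs (Subsingleton PUnit)
  obtain ⟨L, L2, hL, hL2, ⟨e⟩⟩ := hM
  refine ⟨?_, ?_, ⟨_, _, hL.mlambda_zero, hL2.mlambda_id (Z := Mdl.of R PUnit),
      MIso.of_subsingleton hZ e⟩,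
    ⟨_, _, hL.mlambda_id (Z := Mdl.of R PUnit), hL2.mlambda_zero,
      MIso.of_bijective Function.bijective_id e⟩⟩
  · rintro g ⟨t, ht, hg⟩
    obtain ⟨hb, hT⟩ := ht.bijective_and_isTranspose_dom
    have := hT.finite
    obtain ⟨N, hN, hiso⟩ := hg.exists_iso_id hb
    exact ⟨N, ⟨_, hT, hN⟩, hiso⟩
  · rintro g ⟨t, ht, hg⟩
    obtain ⟨hs, hT⟩ := ht.subsingleton_and_isTranspose_cod
    have := hT.finite
    obtain ⟨N, hN, hiso⟩ := hg.exists_iso_zero (Mdl.of R PUnit)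
    exact ⟨N, ⟨_, hT, hN⟩, hiso⟩
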